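/- arXiv:quant-ph/0504133 — 8 statements merged into one kernel-verified Lean document; each statement's English description precedes it below -/
import Mathlib

section
/- Let n be a natural number, c ∈ ZMod 2, and y : Fin (2n+1) → ZMod 2 with y ≠ 0. Then the number of strings x : Fin (2n+1) → ZMod 2 with C(x) = c and x·y = c equals the number of strings x with C(x) = c+1 and x·y = c+1. (Consequently the probability, over a uniform string encoding a fixed bit, that the inner product with y reveals that bit does not depend on which bit was committed.) -/
/-- The number of '11' pairs starting at even positions among the first `2n` bits. -/
def numOnesPairs {n : ℕ} (x : Fin (2 * n + 1) → ZMod 2) : ℕ :=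
  (Finset.univ.filter (fun i : Fin n =>
    x ⟨2 * (i : ℕ), by have := i.isLt; omega⟩ = 1 ∧
    x ⟨2 * (i : ℕ) + 1, by have := i.isLt; omega⟩ = 1)).card

/-- The bit encoded by a string of length `2n+1`. -/
def encBit {n : ℕ} (x : Fin (2 * n + 1) → ZMod 2) : ZMod 2 :=
  (numOnesPairs x : ZMod 2) + x ⟨2 * n, by omega⟩

/-- Inner product of bitstrings, modulo 2. -/
def ip {m : ℕ} (x y : Fin m → ZMod 2) : ZMod 2 := ∑ i, x i * y i

open Finset in
/-- A `ZMod 2`-valued function that is flipped by some translation is balanced. -/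
theorem card_fiber_eq_card_fiber_add_one {G : Type*} [AddGroup G] [Fintype G]
    (f : G → ZMod 2) (e : G) (hf : ∀ x, f (x + e) = f x + 1) (c : ZMod 2) :
    (univ.filter (fun x => f x = c)).card = (univ.filter (fun x => f x = c + 1)).card :=
  card_equiv (Equiv.addRight e) (by simp [hf])

open Finset in
/-- The size of a fiber of `f`, split according to the value of `g`. -/
theorem card_fiber_eq_add {α : Type*} [Fintype α] (f g : α → ZMod 2) (a c : ZMod 2) :
    (univ.filter (fun x => f x = a)).card =
      (univ.filter (fun x => f x = a ∧ g x = c)).card +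
        (univ.filter (fun x => f x = a ∧ g x = c + 1)).card := by
  have h : ∀ u c : ZMod 2, ¬ u = c ↔ u = c + 1 := by decide
  rw [← card_filter_add_card_filter_not (s := univ.filter (fun x => f x = a))
    (fun x => g x = c)]
  simp only [filter_filter, h]

open Finset in
/-- Two balanced `ZMod 2`-valued functions take the values `(c, c)` and `(c + 1, c + 1)`
equally often. -/
theorem card_joint_fiber_eq_of_balanced {α : Type*} [Fintype α] (f g : α → ZMod 2) (c : ZMod 2)
    (hf : (univ.filter (fun x => f x = c)).card = (univ.filter (fun x => f x = c + 1)).card)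
    (hg : (univ.filter (fun x => g x = c)).card = (univ.filter (fun x => g x = c + 1)).card) :
    (univ.filter (fun x => f x = c ∧ g x = c)).card =
      (univ.filter (fun x => f x = c + 1 ∧ g x = c + 1)).card := by
  rw [card_fiber_eq_add f g c c, card_fiber_eq_add f g (c + 1) c] at hf
  rw [card_fiber_eq_add g f c c, card_fiber_eq_add g f (c + 1) c] at hg
  simp only [and_comm (a := g _ = _)] at hg
  lia

/-- Flipping the last bit flips the encoded bit. -/
theorem encBit_add_single_last {n : ℕ} (x : Fin (2 * n + 1) → ZMod 2) :
    encBit (x + Pi.single (Fin.last (2 * n)) 1) = encBit x + 1 := by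
  have hpairs : numOnesPairs (x + Pi.single (Fin.last (2 * n)) 1) = numOnesPairs x := by
    unfold numOnesPairs
    congr 1
    refine Finset.filter_congr fun i _ => ?_
    have hi := i.isLt
    have hne (k : ℕ) (hk : k < 2 * n) : (⟨k, by lia⟩ : Fin (2 * n + 1)) ≠ Fin.last (2 * n) :=
      Fin.ne_of_val_ne hk.ne
    simp only [Pi.add_apply, Pi.single_eq_of_ne (hne (2 * i) (by lia)),
      Pi.single_eq_of_ne (hne (2 * i + 1) (by lia)), add_zero]
  have hlast : (⟨2 * n, by lia⟩ : Fin (2 * n + 1)) = Fin.last (2 * n) := rfl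
  simp only [encBit, hpairs, hlast, Pi.add_apply, Pi.single_eq_same, add_assoc]

/-- Flipping one bit of `x` changes the inner product with `y` by the bit of `y` there. -/
theorem ip_add_single {m : ℕ} (x y : Fin m → ZMod 2) (j : Fin m) :
    ip (x + Pi.single j 1) y = ip x y + y j := by
  simp [ip, add_mul, Finset.sum_add_distrib, Pi.single_apply]

theorem reveal_prob_symmetric (n : ℕ) (c : ZMod 2)
    (y : Fin (2 * n + 1) → ZMod 2) (hy : y ≠ 0) :
    (Finset.univ.filter
        (fun x : Fin (2 * n + 1) → ZMod 2 => encBit x = c ∧ ip x y = c)).card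
      = (Finset.univ.filter
        (fun x : Fin (2 * n + 1) → ZMod 2 => encBit x = c + 1 ∧ ip x y = c + 1)).card := by
  obtain ⟨j, hj⟩ := Function.ne_iff.mp hy
  have hyj : y j = 1 := Fin.eq_one_of_ne_zero _ hj
  exact card_joint_fiber_eq_of_balanced encBit (fun x => ip x y) c
    (card_fiber_eq_card_fiber_add_one _ _ encBit_add_single_last c)
    (card_fiber_eq_card_fiber_add_one _ (Pi.single j 1)
      (fun x => by rw [ip_add_single, hyj]) c)
end

section
/- (Recursion step, non-flipping case.) Let n be a natural number, c ∈ ZMod 2, and y' : Fin (2n+1) → ZMod 2 with y' ≠ 0. Let (u,v) ∈ (ZMod 2)² with (u,v) ≠ (1,1), and let y : Fin (2n+3) → ZMod 2 be the string obtained by prepending u and then v to y' (i.e., y = Fin.cons u (Fin.cons v y')). Then card {x : Fin (2n+3) → ZMod 2 | C(x) = c ∧ x·y = c} = 2^(2n) + 2 · card {x' : Fin (2n+1) → ZMod 2 | C(x') = c ∧ x'·y' = c}. -/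
/-- A string of length `2n+3` is two bits followed by a string of length `2n+1`. -/
def consPairEquiv (n : ℕ) :
    ZMod 2 × ZMod 2 × (Fin (2 * n + 1) → ZMod 2) ≃ (Fin (2 * (n + 1) + 1) → ZMod 2) :=
  ((Equiv.refl _).prodCongr (Fin.consEquiv fun _ : Fin (2 * n + 2) => ZMod 2)).trans
    (Fin.consEquiv fun _ : Fin (2 * n + 3) => ZMod 2)

theorem numOnesPairs_consPair {n : ℕ} (a b : ZMod 2) (x : Fin (2 * n + 1) → ZMod 2) :
    numOnesPairs (consPairEquiv n (a, b, x)) =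
      (if a = 1 ∧ b = 1 then 1 else 0) + numOnesPairs x := by
  unfold numOnesPairs
  rw [Finset.card_filter, Finset.card_filter, Fin.sum_univ_succ]
  rfl

theorem encBit_consPair {n : ℕ} (a b : ZMod 2) (x : Fin (2 * n + 1) → ZMod 2) :
    encBit (consPairEquiv n (a, b, x)) = a * b + encBit x := by
  have hlast : consPairEquiv n (a, b, x) ⟨2 * (n + 1), by omega⟩ = x ⟨2 * n, by omega⟩ := rfl
  have hab : ∀ p q : ZMod 2, ((if p = 1 ∧ q = 1 then 1 else 0 : ℕ) : ZMod 2) = p * q := by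
    decide
  rw [encBit, encBit, numOnesPairs_consPair, hlast, Nat.cast_add, hab, add_assoc]

theorem ip_consPair {n : ℕ} (a b u v : ZMod 2) (x y : Fin (2 * n + 1) → ZMod 2) :
    ip (consPairEquiv n (a, b, x)) (consPairEquiv n (u, v, y)) = a * u + (b * v + ip x y) := by
  unfold ip
  refine (Fin.sum_univ_succ (n := 2 * n + 2) _).trans (congrArg₂ _ rfl ?_)
  exact Fin.sum_univ_succ (n := 2 * n + 1) _

/-- A nonzero linear functional over `ZMod 2` takes each value equally often. -/
theorem card_ip_eq {m : ℕ} {y : Fin (m + 1) → ZMod 2} (hy : y ≠ 0) (t : ZMod 2) :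
    (Finset.univ.filter fun x => ip x y = t).card = 2 ^ m := by
  obtain ⟨j, hj⟩ := Function.ne_iff.mp hy
  have hj1 : y j = 1 := (by decide : ∀ z : ZMod 2, z ≠ 0 → z = 1) _ hj
  have hshift (x : Fin (m + 1) → ZMod 2) : ip (x + Pi.single j 1) y = ip x y + 1 := by
    simp [ip, add_mul, Finset.sum_add_distrib, Pi.single_apply, hj1]
  have heq : (Finset.univ.filter fun x => ip x y = t).card =
      (Finset.univ.filter fun x => ¬ ip x y = t).card := by
    refine Finset.card_equiv (Equiv.addRight (Pi.single j 1)) fun x => ?_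
    simp only [Finset.mem_filter, Finset.mem_univ, true_and, Equiv.coe_addRight, hshift]
    generalize ip x y = s
    decide +revert
  have htot := Finset.card_filter_add_card_filter_not (s := Finset.univ)
    (fun x : Fin (m + 1) → ZMod 2 => ip x y = t)
  rw [← heq, Finset.card_univ, Fintype.card_fun, ZMod.card, Fintype.card_fin, pow_succ] at htot
  omega

theorem card_encBit_add_card_encBit {n : ℕ} {y : Fin (2 * n + 1) → ZMod 2} (hy : y ≠ 0)
    (s t : ZMod 2) :
    (Finset.univ.filter fun x => encBit x = s ∧ ip x y = t).card +
      (Finset.univ.filter fun x => encBit x = s + 1 ∧ ip x y = t).card = 2 ^ (2 * n) := by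
  rw [← card_ip_eq hy t, ← Finset.card_filter_add_card_filter_not
    (s := Finset.univ.filter fun x => ip x y = t) (fun x => encBit x = s),
    Finset.filter_filter, Finset.filter_filter]
  congr 2 <;> ext x <;> simp only [Finset.mem_filter, Finset.mem_univ, true_and]
  · exact and_comm
  · rw [and_comm]
    refine and_congr_right fun _ => ?_
    generalize encBit x = r
    decide +revert

theorem card_consPair {n : ℕ} (c u v : ZMod 2) (y : Fin (2 * n + 1) → ZMod 2) :
    (Finset.univ.filter fun x => encBit x = c ∧ ip x (consPairEquiv n (u, v, y)) = c).card =
      ∑ a : ZMod 2, ∑ b : ZMod 2, (Finset.univ.filter fun x =>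
        encBit x = c + a * b ∧ ip x y = c + (a * u + b * v)).card := by
  have hmove (p q : ZMod 2) : p + q = c ↔ q = c + p := by decide +revert
  simp only [Finset.card_filter]
  rw [← (consPairEquiv n).sum_comp, Fintype.sum_prod_type]
  simp only [Fintype.sum_prod_type, encBit_consPair, ip_consPair, ← add_assoc, hmove]

theorem recursion_step_nonflipping (n : ℕ) (c : ZMod 2)
    (y' : Fin (2 * n + 1) → ZMod 2) (hy' : y' ≠ 0)
    (u v : ZMod 2) (huv : (u, v) ≠ (1, 1))
    (y : Fin (2 * (n + 1) + 1) → ZMod 2)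
    (hy : y = Fin.cons u (Fin.cons v y') ∘ Fin.cast (by omega)) :
    (Finset.univ.filter
        (fun x : Fin (2 * (n + 1) + 1) → ZMod 2 => encBit x = c ∧ ip x y = c)).card
      = 2 ^ (2 * n) + 2 *
        (Finset.univ.filter
          (fun x' : Fin (2 * n + 1) → ZMod 2 => encBit x' = c ∧ ip x' y' = c)).card := by
  have hy2 : y = consPairEquiv n (u, v, y') := hy
  have hsum (f : ZMod 2 → ℕ) : ∑ a, f a = f 0 + f 1 := Fin.sum_univ_two f
  have h01 : ∀ z : ZMod 2, z = 0 ∨ z = 1 := by decide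
  have h0 := card_encBit_add_card_encBit hy' c c
  have h1 := card_encBit_add_card_encBit hy' c (c + 1)
  rw [hy2, card_consPair]
  simp only [hsum]
  rcases h01 u with rfl | rfl <;> rcases h01 v with rfl | rfl
  · simp only [mul_zero, mul_one, add_zero]
    omega
  · simp only [mul_zero, mul_one, add_zero, zero_add]
    omega
  · simp only [mul_zero, mul_one, add_zero]
    omega
  · exact absurd rfl huv
end

section
/- (Lemma 1 of the paper: one block leaks almost nothing to Bob.) Let n be a natural number, c ∈ ZMod 2, and y : Fin (2n+1) → ZMod 2 with y ≠ 0. Then the probability, over a uniformly random x among the strings with C(x) = c, that x·y = c is within 2^(−(n+1)) of 1/2; concretely, as real numbers, |card {x : Fin (2n+1) → ZMod 2 | C(x) = c ∧ x·y = c} / 2^(2n) − 1/2| ≤ 2^(−(n+1)). -/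
/-- The nontrivial character of `ZMod 2`, with values `1` and `-1`. -/
def signChar : AddChar (ZMod 2) ℤ where
  toFun a := if a = 0 then 1 else -1
  map_zero_eq_one' := rfl
  map_add_eq_mul' := by decide

theorem sum_fin_two_mul_add_one {M : Type*} [AddCommMonoid M] (n : ℕ) (f : Fin (2 * n + 1) → M) :
    ∑ k, f k = ∑ i : Fin n, (f ⟨2 * (i : ℕ), by omega⟩ + f ⟨2 * (i : ℕ) + 1, by omega⟩)
      + f ⟨2 * n, by omega⟩ := by
  induction n with
  | zero => simp
  | succ n ih =>
    refine (Fin.sum_univ_castSucc (n := 2 * n + 1 + 1) f).trans ?_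
    rw [Fin.sum_univ_castSucc (n := 2 * n + 1), ih,
      Fin.sum_univ_castSucc (n := n)]
    simp only [add_assoc]
    rfl

theorem numOnesPairs_cast {n : ℕ} (x : Fin (2 * n + 1) → ZMod 2) :
    (numOnesPairs x : ZMod 2) =
      ∑ i : Fin n, x ⟨2 * (i : ℕ), by omega⟩ * x ⟨2 * (i : ℕ) + 1, by omega⟩ := by
  have h : ∀ a b : ZMod 2, (if a = 1 ∧ b = 1 then 1 else 0) = a * b := by decide
  simp [numOnesPairs, ← h]

/-- The consecutive pairs of a string of odd length, together with its last bit. -/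
def pairs {n : ℕ} (x : Fin (2 * n + 1) → ZMod 2) : (Fin n → ZMod 2 × ZMod 2) × ZMod 2 :=
  (fun i => (x ⟨2 * (i : ℕ), by omega⟩, x ⟨2 * (i : ℕ) + 1, by omega⟩), x ⟨2 * n, by omega⟩)

theorem pairs_bijective (n : ℕ) : Function.Bijective (pairs (n := n)) := by
  rw [Fintype.bijective_iff_injective_and_card]
  refine ⟨fun x x' h => ?_, ?_⟩
  · simp only [pairs, Prod.mk.injEq, funext_iff] at h
    obtain ⟨hpairs, hlast⟩ := h
    funext ⟨k, hk⟩
    rcases Nat.even_or_odd' k with ⟨i, rfl | rfl⟩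
    · rcases (show i < n ∨ i = n by omega) with hi | rfl
      · exact (hpairs ⟨i, hi⟩).1
      · exact hlast
    · exact (hpairs ⟨i, by omega⟩).2
  · simp [ZMod.card, pow_succ, pow_mul]

theorem sum_signChar_encBit_add_ip {n : ℕ} (z : Fin (2 * n + 1) → ZMod 2) :
    ∑ x, signChar (encBit x + ip x z) =
      (∏ i : Fin n, ∑ p : ZMod 2 × ZMod 2, signChar (p.1 * p.2 +
        (p.1 * z ⟨2 * (i : ℕ), by omega⟩ + p.2 * z ⟨2 * (i : ℕ) + 1, by omega⟩))) *
      ∑ t, signChar (t + t * z ⟨2 * n, by omega⟩) := by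
  rw [Fintype.prod_sum, Fintype.sum_mul_sum, ← Fintype.sum_prod_type']
  refine Fintype.sum_bijective pairs (pairs_bijective n) _ _ fun x => ?_
  rw [encBit, numOnesPairs_cast, ip, sum_fin_two_mul_add_one, add_add_add_comm,
    ← Finset.sum_add_distrib, AddChar.map_add_eq_mul]
  exact congrArg (· * _) (map_prod signChar.toMonoidHom _ Finset.univ)

theorem abs_sum_signChar_encBit_add_ip_le {n : ℕ} (z : Fin (2 * n + 1) → ZMod 2) :
    |∑ x, signChar (encBit x + ip x z)| ≤ 2 ^ (n + 1) := by
  have hpair : ∀ a b : ZMod 2,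
      |∑ p : ZMod 2 × ZMod 2, signChar (p.1 * p.2 + (p.1 * a + p.2 * b))| = 2 := by decide
  have hlast : ∀ a : ZMod 2, |∑ t, signChar (t + t * a)| ≤ 2 := by decide
  rw [sum_signChar_encBit_add_ip, abs_mul, Finset.abs_prod]
  simp only [hpair, Finset.prod_const, Finset.card_univ, Fintype.card_fin, pow_succ]
  gcongr
  exact hlast _

theorem sum_signChar_encBit (n : ℕ) :
    ∑ x : Fin (2 * n + 1) → ZMod 2, signChar (encBit x) = 0 := by
  have hlast : ∑ t : ZMod 2, signChar t = 0 := by decide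
  have h := sum_signChar_encBit_add_ip (0 : Fin (2 * n + 1) → ZMod 2)
  simpa [ip, hlast] using h

theorem sum_signChar_ip {m : ℕ} {y : Fin m → ZMod 2} (hy : y ≠ 0) :
    ∑ x, signChar (ip x y) = 0 := by
  let ipHom : (Fin m → ZMod 2) →+ ZMod 2 :=
    AddMonoidHom.mk' (fun x => ip x y) fun a b => by simp [ip, add_mul, Finset.sum_add_distrib]
  refine AddChar.sum_eq_zero_of_ne_one (ψ := signChar.compAddMonoidHom ipHom) fun h => ?_
  obtain ⟨k, hk⟩ := Function.ne_iff.mp hy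
  have hsign : ∀ a : ZMod 2, signChar a = 1 → a = 0 := by decide
  refine hk (hsign _ ?_)
  have hsingle : ip (Pi.single k 1) y = y k := by simp [ip, Pi.single_apply]
  rw [← hsingle]
  exact DFunLike.congr_fun h (Pi.single k 1)

theorem four_mul_card_encBit_ip {n : ℕ} (c : ZMod 2) {y : Fin (2 * n + 1) → ZMod 2} (hy : y ≠ 0) :
    4 * ((Finset.univ.filter
        (fun x : Fin (2 * n + 1) → ZMod 2 => encBit x = c ∧ ip x y = c)).card : ℤ) =
      2 ^ (2 * n + 1) + ∑ x, signChar (encBit x + ip x y) := by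
  have h : ∀ a b c : ZMod 2, 4 * (if a = c ∧ b = c then (1 : ℤ) else 0) =
      1 + signChar c * signChar a + signChar c * signChar b + signChar (a + b) := by decide
  rw [← Finset.sum_boole, Finset.mul_sum]
  simp only [h, Finset.sum_add_distrib, ← Finset.mul_sum, sum_signChar_encBit, sum_signChar_ip hy]
  simp [ZMod.card]

/-- Lemma 1: one block leaks almost nothing to Bob. -/
theorem one_block_leaks_little (n : ℕ) (c : ZMod 2)
    (y : Fin (2 * n + 1) → ZMod 2) (hy : y ≠ 0) :
    |((Finset.univ.filter
        (fun x : Fin (2 * n + 1) → ZMod 2 => encBit x = c ∧ ip x y = c)).card : ℝ)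
        / 2 ^ (2 * n) - 1 / 2|
      ≤ 1 / 2 ^ (n + 1) := by
  have hcard := congrArg (Int.cast (R := ℝ)) (four_mul_card_encBit_ip c hy)
  have hbound := Int.cast_le (R := ℝ).mpr (abs_sum_signChar_encBit_add_ip_le y)
  generalize ∑ x, signChar (encBit x + ip x y) = S at hcard hbound
  push_cast at hcard hbound
  generalize ((Finset.univ.filter
    (fun x : Fin (2 * n + 1) → ZMod 2 => encBit x = c ∧ ip x y = c)).card : ℝ) = N at hcard ⊢
  have hN : N / 2 ^ (2 * n) - 1 / 2 = S / (4 * 2 ^ (2 * n)) := by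
    field_simp
    rw [pow_succ] at hcard
    linarith
  rw [hN, abs_div, abs_of_pos (by positivity : (0 : ℝ) < 4 * 2 ^ (2 * n)),
    div_le_div_iff₀ (by positivity) (by positivity)]
  calc |(S : ℝ)| * 2 ^ (n + 1) ≤ 2 ^ (n + 1) * 2 ^ (n + 1) := by gcongr
    _ = 1 * (4 * 2 ^ (2 * n)) := by ring
end

section
/- (Lemma 2 of the paper, abstract form: Bob's guessing probability over k blocks.) Fix k ∈ ℕ and ε : Fin k → ℝ with 0 ≤ εᵢ ≤ 1/2 for all i. Define the weight w : Bool × (Fin k → Bool) → ℝ by w(c, r) = (1/2) · ∏ᵢ (if rᵢ = c then 1/2 + εᵢ else 1/2 − εᵢ); this is a probability distribution (the joint distribution of a uniformly random committed bit c together with k conditionally independent hints rᵢ, each agreeing with c with probability 1/2 + εᵢ). Then for every guessing function g : (Fin k → Bool) → Bool, the probability of a correct guess satisfies ∑_{(c,r) : g(r) = c} w(c,r) ≤ 1/2 + ∑ᵢ εᵢ. In particular, if each εᵢ ≤ 2^(−(n+1)), the guessing probability is at most 1/2 + k/2^(n+1). -/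
/-- The conditional probability of the hints `r` given the bit `c`. -/
noncomputable def hintWeight {k : ℕ} (ε : Fin k → ℝ) (c : Bool) (r : Fin k → Bool) : ℝ :=
  ∏ i, (if r i = c then 1 / 2 + ε i else 1 / 2 - ε i)

theorem hintWeight_nonneg {k : ℕ} {ε : Fin k → ℝ} (hε : ∀ i, 0 ≤ ε i ∧ ε i ≤ 1 / 2)
    (c : Bool) (r : Fin k → Bool) : 0 ≤ hintWeight ε c r := by
  refine Finset.prod_nonneg fun i _ => ?_
  have := hε i
  split_ifs <;> linarith

theorem sum_hintWeight {k : ℕ} (ε : Fin k → ℝ) (c : Bool) : ∑ r, hintWeight ε c r = 1 := by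
  have h := Fintype.prod_sum fun (i : Fin k) (b : Bool) =>
    if b = c then 1 / 2 + ε i else 1 / 2 - ε i
  unfold hintWeight
  rw [← h]
  refine Finset.prod_eq_one fun i _ => ?_
  cases c <;> simp <;> ring

theorem hintWeight_cons {k : ℕ} (ε : Fin (k + 1) → ℝ) (c b : Bool) (r : Fin k → Bool) :
    hintWeight ε c (Fin.cons b r) =
      (if b = c then 1 / 2 + ε 0 else 1 / 2 - ε 0) * hintWeight (Fin.tail ε) c r := by
  simp [hintWeight, Fin.prod_univ_succ, Fin.tail]

theorem sum_hintWeight_guess_le {k : ℕ} (ε : Fin k → ℝ) (hε : ∀ i, 0 ≤ ε i ∧ ε i ≤ 1 / 2)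
    (g : (Fin k → Bool) → Bool) : ∑ r, hintWeight ε (g r) r ≤ 1 + 2 * ∑ i, ε i := by
  induction k with
  | zero => simp [hintWeight]
  | succ k ih =>
    have hε' : ∀ i, 0 ≤ Fin.tail ε i ∧ Fin.tail ε i ≤ 1 / 2 := fun i => hε i.succ
    obtain ⟨h0, h1⟩ := hε 0
    have hsum : 0 ≤ ∑ i, Fin.tail ε i := Finset.sum_nonneg fun i _ => (hε' i).1
    have bound (b : Bool) : ∑ r, hintWeight ε (g (Fin.cons b r)) (Fin.cons b r) ≤
        (1 / 2 - ε 0) * (1 + 2 * ∑ i, Fin.tail ε i) + 2 * ε 0 := by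
      calc
        _ ≤ ∑ r, ((1 / 2 - ε 0) * hintWeight (Fin.tail ε) (g (Fin.cons b r)) r +
              2 * ε 0 * hintWeight (Fin.tail ε) b r) := by
          refine Finset.sum_le_sum fun r _ => ?_
          rw [hintWeight_cons]
          have hb := hintWeight_nonneg hε' b r
          split_ifs with h
          · rw [← h]
            linarith
          · have := mul_nonneg h0 hb
            linarith
        _ ≤ _ := by
          rw [Finset.sum_add_distrib, ← Finset.mul_sum, ← Finset.mul_sum, sum_hintWeight, mul_one]
          have := mul_le_mul_of_nonneg_left (ih (Fin.tail ε) hε' fun r => g (Fin.cons b r))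
            (sub_nonneg.2 h1)
          linarith
    have split : ∑ r, hintWeight ε (g r) r =
        ∑ b : Bool, ∑ r, hintWeight ε (g (Fin.cons b r)) (Fin.cons b r) := by
      rw [← Fintype.sum_prod_type', ← (Fin.consEquiv fun _ : Fin (k + 1) => Bool).sum_comp]
      rfl
    have ht : ∑ i, ε i = ε 0 + ∑ i, Fin.tail ε i := Fin.sum_univ_succ ε
    rw [split, Fintype.sum_bool, ht]
    have := mul_nonneg h0 hsum
    linarith [bound true, bound false]

/-- Lemma 2 (abstract form): Bob's guessing probability over `k` blocks. -/
theorem guessing_probability_bound (k : ℕ) (ε : Fin k → ℝ)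
    (hε : ∀ i, 0 ≤ ε i ∧ ε i ≤ 1 / 2)
    (g : (Fin k → Bool) → Bool) :
    ∑ p ∈ Finset.univ.filter (fun p : Bool × (Fin k → Bool) => g p.2 = p.1),
        (1 / 2 : ℝ) * ∏ i, (if p.2 i = p.1 then 1 / 2 + ε i else 1 / 2 - ε i)
      ≤ 1 / 2 + ∑ i, ε i := by
  have h := sum_hintWeight_guess_le ε hε g
  change ∑ p ∈ Finset.univ.filter (fun p : Bool × (Fin k → Bool) => g p.2 = p.1),
    (1 / 2 : ℝ) * hintWeight ε p.1 p.2 ≤ _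
  rw [← Finset.mul_sum, Finset.sum_filter, Fintype.sum_prod_type_right]
  simp only [Finset.sum_ite_eq, Finset.mem_univ, if_true]
  linarith
end

section
/- (Binding analysis, general bound.) Let k₀, k₁, k⋆ be natural numbers and set k = k₀ + k₁ + k⋆. If k ≥ 2, then (1/2)^{k₀} · (3/4)^{k⋆} + (1/2)^{k₁} · (3/4)^{k⋆} ≤ 1 + (1/2)^{k−2} (as real numbers). Hence the sum of Alice's acceptance probabilities for revealing 0 and for revealing 1 in the k-block protocol is at most 1 + (1/2)^{k−2}. -/
/-- Binding analysis, general bound. -/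
theorem binding_general_bound (k₀ k₁ kstar : ℕ) (k : ℕ)
    (hk : k = k₀ + k₁ + kstar) (h : 2 ≤ k) :
    (1 / 2 : ℝ) ^ k₀ * (3 / 4) ^ kstar + (1 / 2 : ℝ) ^ k₁ * (3 / 4) ^ kstar
      ≤ 1 + (1 / 2 : ℝ) ^ (k - 2) := by
  have hpow : (1 / 2 : ℝ) ^ (k - 2) =
      4 * ((1 / 2) ^ k₀ * (1 / 2) ^ k₁ * (1 / 2) ^ kstar) := by
    rw [← pow_add, ← pow_add, ← hk]
    obtain ⟨m, rfl⟩ := Nat.exists_eq_add_of_le h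
    rw [Nat.add_sub_cancel_left, pow_add]
    ring
  rw [hpow]
  have ha : (1 / 2 : ℝ) ^ k₀ ≤ 1 := pow_le_one₀ (by norm_num) (by norm_num)
  have hb : (1 / 2 : ℝ) ^ k₁ ≤ 1 := pow_le_one₀ (by norm_num) (by norm_num)
  have hab : (0 : ℝ) < (1 / 2) ^ k₀ * (1 / 2) ^ k₁ := by positivity
  have hsum := mul_nonneg (sub_nonneg.2 ha) (sub_nonneg.2 hb)
  obtain hs | hs := lt_or_ge kstar 3
  · clear hpow hk
    generalize (1 / 2 : ℝ) ^ k₀ = a at *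
    generalize (1 / 2 : ℝ) ^ k₁ = b at *
    interval_cases kstar <;> norm_num <;> nlinarith
  · have hc : (3 / 4 : ℝ) ^ kstar ≤ (3 / 4) ^ 3 :=
      pow_le_pow_of_le_one (by norm_num) (by norm_num) hs
    have hc0 : (0 : ℝ) ≤ (3 / 4) ^ kstar := by positivity
    have hd : (0 : ℝ) ≤ (1 / 2) ^ k₀ * (1 / 2) ^ k₁ * (1 / 2) ^ kstar := by positivity
    have h₀ := mul_le_of_le_one_left hc0 ha
    have h₁ := mul_le_of_le_one_left hc0 hb
    norm_num at hc
    linarith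
end

section
/- (Security against Bob in the oblivious-transfer protocol: binomial tail bound after cheating on k boxes.) Let n, k be natural numbers with 3k < n. Then ∑_{j ∈ Finset.range (n−k+1), 3j ≤ n} Nat.choose (n−k) j ≤ 2^{n−k} · Real.exp (−((n : ℝ) − 3k)² / (18 · ((n : ℝ) − k))). Equivalently, if S is the number of heads in n−k fair coin flips, then Pr(S ≤ n/3) ≤ exp(−(n−3k)²/(18(n−k))). -/
/-- The moment generating function of a sum of `m` Rademacher variables is subgaussian. -/
theorem sum_choose_mul_exp_le (m : ℕ) (s : ℝ) :
    ∑ j ∈ Finset.range (m + 1), (m.choose j : ℝ) * Real.exp (s * (m - 2 * j))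
      ≤ 2 ^ m * Real.exp (m * (s ^ 2 / 2)) := by
  have hsum : ∑ j ∈ Finset.range (m + 1), (m.choose j : ℝ) * Real.exp (s * (m - 2 * j))
      = (2 * Real.cosh s) ^ m := by
    rw [Real.cosh_eq, mul_div_cancel₀ _ (two_ne_zero' ℝ), add_comm (Real.exp s), add_pow]
    refine Finset.sum_congr rfl fun j hj => ?_
    rw [← Real.exp_nat_mul, ← Real.exp_nat_mul, ← Real.exp_add,
      Nat.cast_sub (Finset.mem_range_succ_iff.mp hj), mul_comm]
    congr 2
    ring
  rw [hsum, mul_pow, Real.exp_nat_mul]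
  gcongr
  exact Real.cosh_le_exp_half_sq s

/-- Hoeffding's inequality for the lower tail of a symmetric binomial distribution. -/
theorem sum_choose_filter_le (m : ℕ) (hm : 0 < m) (p : ℕ → Prop) [DecidablePred p] (t : ℝ)
    (ht : 0 ≤ t) (hp : ∀ j, p j → (j : ℝ) ≤ m / 2 - t) :
    ∑ j ∈ (Finset.range (m + 1)).filter p, (m.choose j : ℝ)
      ≤ 2 ^ m * Real.exp (-(2 * t ^ 2 / m)) := by
  have hm' : (0 : ℝ) < m := Nat.cast_pos.mpr hm
  set s : ℝ := 2 * t / m with hs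
  have hs0 : 0 ≤ s := by positivity
  have key : (∑ j ∈ (Finset.range (m + 1)).filter p, (m.choose j : ℝ)) * Real.exp (s * (2 * t))
      ≤ 2 ^ m * Real.exp (m * (s ^ 2 / 2)) := by
    refine le_trans ?_ (sum_choose_mul_exp_le m s)
    rw [Finset.sum_mul]
    refine le_trans (Finset.sum_le_sum fun j hj => ?_)
      (Finset.sum_le_sum_of_subset_of_nonneg (Finset.filter_subset p _)
        fun j _ _ => by positivity)
    have := hp j (Finset.mem_filter.mp hj).2
    gcongr
    linarith
  rw [← le_div_iff₀ (Real.exp_pos _), mul_div_assoc, ← Real.exp_sub] at key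
  have hexp : (m : ℝ) * (s ^ 2 / 2) - s * (2 * t) = -(2 * t ^ 2 / m) := by
    rw [hs]
    field_simp
    ring
  rwa [hexp] at key

/-- Security against Bob: binomial tail bound after cheating on `k` boxes,
`Pr(S ≤ n/3) ≤ exp(−(n−3k)²/(18(n−k)))` for `S ∼ Binomial(n−k, 1/2)`. -/
theorem ot_security_tail_bound (n k : ℕ) (h : 3 * k < n) :
    ((∑ j ∈ (Finset.range (n - k + 1)).filter (fun j => 3 * j ≤ n),
        Nat.choose (n - k) j : ℕ) : ℝ)
      ≤ 2 ^ (n - k) * Real.exp (-((n : ℝ) - 3 * k) ^ 2 / (18 * ((n : ℝ) - k))) := by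
  have hc : ((n - k : ℕ) : ℝ) = n - k := Nat.cast_sub (by omega)
  have h' : 3 * (k : ℝ) < n := by exact_mod_cast h
  have hpos : (0 : ℝ) < n - k := by
    have : (0 : ℝ) ≤ k := k.cast_nonneg
    linarith
  have key := sum_choose_filter_le (n - k) (by omega) (fun j => 3 * j ≤ n)
    (((n : ℝ) - 3 * k) / 6) (by linarith) fun j hj => by
      have : 3 * (j : ℝ) ≤ n := by exact_mod_cast hj
      rw [hc]
      linarith
  have hexp : -(2 * (((n : ℝ) - 3 * k) / 6) ^ 2 / ((n - k : ℕ) : ℝ))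
      = -((n : ℝ) - 3 * k) ^ 2 / (18 * ((n : ℝ) - k)) := by
    rw [hc]
    field_simp
    ring
  rwa [hexp, ← Nat.cast_sum] at key
end

section
/- (Security against Bob: the combined cheating probability decays exponentially.) For all natural numbers n ≥ 1 and k with k < n, the real number (3/4)^k · Real.exp (−((n : ℝ) − 3k)² / (18 · ((n : ℝ) − k))) is at most Real.exp (−(n : ℝ)/72). Hence the probability that a dishonest Bob cheats undetected on k boxes and still passes the binomial threshold — and thereby learns both of Alice's input bits — can be made arbitrarily small by choosing n large, uniformly in k. -/
/-- Security against Bob: the combined cheating probability decays exponentially,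
uniformly in the number `k` of boxes cheated on. -/
theorem ot_combined_cheating_bound (n k : ℕ) (hn : 1 ≤ n) (hk : k < n) :
    (3 / 4 : ℝ) ^ k * Real.exp (-((n : ℝ) - 3 * k) ^ 2 / (18 * ((n : ℝ) - k)))
      ≤ Real.exp (-(n : ℝ) / 72) := by
  have hpos : (0 : ℝ) < n - k := sub_pos.mpr (by exact_mod_cast hk)
  have hbase : (3 / 4 : ℝ) ≤ Real.exp (-(1 / 4)) := by
    have := Real.add_one_le_exp (-(1 / 4) : ℝ)
    linarith
  have hpow : (3 / 4 : ℝ) ^ k ≤ Real.exp (k * -(1 / 4)) := by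
    rw [Real.exp_nat_mul]
    gcongr
  have hexponent : (k : ℝ) * -(1 / 4) + -((n : ℝ) - 3 * k) ^ 2 / (18 * ((n : ℝ) - k))
      ≤ -(n : ℝ) / 72 := by
    have h : -((n : ℝ) - 3 * k) ^ 2 / (18 * ((n : ℝ) - k)) ≤ -(n : ℝ) / 72 + k / 4 := by
      rw [div_le_iff₀ (by positivity)]
      nlinarith [sq_nonneg (6 * (n : ℝ) - 5 * k), sq_nonneg (k : ℝ)]
    linarith
  calc (3 / 4 : ℝ) ^ k * Real.exp (-((n : ℝ) - 3 * k) ^ 2 / (18 * ((n : ℝ) - k)))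
      ≤ Real.exp (k * -(1 / 4)) *
          Real.exp (-((n : ℝ) - 3 * k) ^ 2 / (18 * ((n : ℝ) - k))) := by gcongr
    _ ≤ Real.exp (-(n : ℝ) / 72) := by
      rw [← Real.exp_add]
      exact Real.exp_le_exp.mpr hexponent
end

section
/- (CHSH/Bell inequality for local hidden-variable models.) Let Λ be a finite type and μ : Λ → ℝ a probability weight (μ λ ≥ 0 for all λ and ∑_λ μ λ = 1). Let a : Bool → Λ → Bool and b : Bool → Λ → Bool be local response functions. Then ∑_{x ∈ Bool} ∑_{y ∈ Bool} (∑_{λ : xor (a x λ) (b y λ) = (x && y)} μ λ) ≤ 3. That is, for any strategy based on shared randomness, ∑_{x,y ∈ {0,1}} Pr(a_x ⊕ b_y = x·y) ≤ 3. -/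
/-- CHSH/Bell inequality for local hidden-variable models:
`∑_{x,y ∈ {0,1}} Pr(a_x ⊕ b_y = x·y) ≤ 3`. -/
theorem chsh_local_hidden_variable_bound (Λ : Type*) [Fintype Λ]
    (μ : Λ → ℝ) (hμ0 : ∀ l, 0 ≤ μ l) (hμ1 : ∑ l, μ l = 1)
    (a b : Bool → Λ → Bool) :
    ∑ x : Bool, ∑ y : Bool,
        (∑ l ∈ Finset.univ.filter (fun l => xor (a x l) (b y l) = (x && y)), μ l)
      ≤ 3 := by
  have hsum : ∑ l, 3 * μ l = 3 := by rw [← Finset.mul_sum, hμ1, mul_one]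
  rw [← hsum]
  simp only [Fintype.sum_bool, Finset.sum_filter, ← Finset.sum_add_distrib]
  refine Finset.sum_le_sum fun l _ => ?_
  have hl := hμ0 l
  cases a true l <;> cases a false l <;> cases b true l <;> cases b false l <;>
    simp <;> linarith
end
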